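/- Let n ≥ 0 be an integer and let x, y be real numbers with x ≠ y. Then Σ_{k=0}^{n} B_k(x) B_{n-k}(y) − Σ_{l=0}^{n} C(n+1, l+1) · (B_l(x-y) B_{n-l}(y) + B_l(y-x) B_{n-l}(x)) / (l+2) = (B_{n+1}(x) + B_{n+1}(y)) / (x−y)² − (2/(n+2)) · (B_{n+2}(x) − B_{n+2}(y)) / (x−y)³. -/

import Mathlib

open Finset

/-- The `n`-th Bernoulli polynomial evaluated at a real `x`:
`B_n(x) = ∑_{k=0}^n (n choose k) B_k x^(n-k)`, where `B_k` is the `k`-th Bernoulli number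
(with the convention `B_1 = -1/2`, i.e. generating function `z e^{xz}/(e^z - 1)`). -/
noncomputable def bernoulliPoly (n : ℕ) (x : ℝ) : ℝ :=
  ∑ k ∈ Finset.range (n + 1), ((bernoulli k : ℚ) : ℝ) * (n.choose k : ℝ) * x ^ (n - k)

/-- The `n`-th harmonic number `H_n = ∑_{k=1}^n 1/k` as a real number. -/
noncomputable def harm (n : ℕ) : ℝ :=
  ∑ k ∈ Finset.range n, (1 : ℝ) / (k + 1)

lemma bP_eq (n : ℕ) (x : ℝ) : bernoulliPoly n x = Polynomial.aeval x (Polynomial.bernoulli n) := by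
  simp only [bernoulliPoly, Polynomial.bernoulli, map_sum, Polynomial.aeval_monomial]
  simp

lemma bP_deriv (n : ℕ) (x : ℝ) :
    HasDerivAt (bernoulliPoly n) ((n : ℝ) * bernoulliPoly (n - 1) x) x := by
  have h := (Polynomial.bernoulli n).hasDerivAt_aeval x
  rw [Polynomial.derivative_bernoulli] at h
  have e : bernoulliPoly n = fun x => Polynomial.aeval x (Polynomial.bernoulli n) := by
    funext x; exact bP_eq n x
  rw [e, bP_eq]
  simpa using h

lemma bP_shift (n : ℕ) (x : ℝ) :
    bernoulliPoly n (1 + x) = bernoulliPoly n x + n * x ^ (n - 1) := by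
  have h := congrArg (Polynomial.aeval x) (Polynomial.bernoulli_comp_one_add_X n)
  rw [Polynomial.aeval_comp] at h
  simp only [bP_eq]
  simpa using h

lemma bP_zero (x : ℝ) : bernoulliPoly 0 x = 1 := by simp [bernoulliPoly]

lemma const_of_deriv (f : ℝ → ℝ) (h : ∀ y, HasDerivAt f 0 y) (y z : ℝ) : f y = f z :=
  is_const_of_deriv_eq_zero (fun y => (h y).differentiableAt) (fun y => (h y).deriv) y z

lemma bP_add (n : ℕ) : ∀ (x y : ℝ), bernoulliPoly n (x + y) =
    ∑ l ∈ Finset.range (n + 1), (n.choose l : ℝ) * bernoulliPoly l x * y ^ (n - l) := by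
  induction n with
  | zero => intro x y; simp [bP_zero]
  | succ n ih =>
    intro x y
    have key := const_of_deriv (fun y => bernoulliPoly (n + 1) (x + y) -
      ∑ l ∈ Finset.range (n + 1 + 1), ((n + 1).choose l : ℝ) * bernoulliPoly l x *
        y ^ (n + 1 - l)) ?_ y 0
    · have e : ∑ l ∈ Finset.range (n + 1 + 1), ((n + 1).choose l : ℝ) * bernoulliPoly l x *
        (0:ℝ) ^ (n + 1 - l) = bernoulliPoly (n + 1) x := by
        rw [Finset.sum_range_succ, Finset.sum_eq_zero]
        · simp
        · intro l hl
          have : n + 1 - l ≠ 0 := by have := Finset.mem_range.1 hl; omega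
          simp [this]
      simp only [add_zero, e, sub_self] at key
      linarith
    · intro y
      have h1 : HasDerivAt (fun y => bernoulliPoly (n + 1) (x + y)) _ y :=
        (bP_deriv (n + 1) (x + y)).comp_const_add x y
      have h2 : HasDerivAt (fun y : ℝ => ∑ l ∈ Finset.range (n + 1 + 1),
          ((n + 1).choose l : ℝ) * bernoulliPoly l x * y ^ (n + 1 - l)) _ y :=
        HasDerivAt.fun_sum (fun l _ => (hasDerivAt_pow (n + 1 - l) y).const_mul _)
      refine (h1.sub h2).congr_deriv ?_
      rw [Finset.sum_range_succ, Nat.add_sub_cancel, ih, Finset.mul_sum]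
      rw [sub_eq_zero]
      simp only [Nat.sub_self, Nat.cast_zero, zero_mul, mul_zero, add_zero]
      refine Finset.sum_congr rfl fun l hl => ?_
      have hl' := Finset.mem_range.1 hl
      have c := Nat.choose_mul_succ_eq n l
      have c' : (n.choose l : ℝ) * (n + 1) = (n + 1).choose l * ((n + 1 - l : ℕ) : ℝ) := by
        exact_mod_cast c
      have e : n + 1 - l - 1 = n - l := by omega
      rw [e]
      push_cast
      linear_combination (bernoulliPoly l x * y ^ (n - l)) * c'

lemma bP_inv (n : ℕ) (d : ℝ) :
    ∑ l ∈ Finset.range (n + 1), (n.choose l : ℝ) * bernoulliPoly l (-d) * d ^ (n - l)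
      = bernoulliPoly n 0 := by
  rw [← bP_add]; simp

lemma H_eq (n : ℕ) (d : ℝ) :
    ∑ l ∈ Finset.range (n + 1), ((n + 1).choose (l + 1) : ℝ) * bernoulliPoly l (-d) * d ^ (n - l)
      = ∑ k ∈ Finset.range (n + 1), d ^ k * bernoulliPoly (n - k) 0 := by
  induction n with
  | zero => simp [bP_zero]
  | succ n ih =>
    rw [Finset.sum_range_succ' (fun k => d ^ k * bernoulliPoly (n + 1 - k) 0)]
    have e : ∑ k ∈ Finset.range (n + 1), d ^ (k + 1) * bernoulliPoly (n + 1 - (k + 1)) 0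
        = d * ∑ k ∈ Finset.range (n + 1), d ^ k * bernoulliPoly (n - k) 0 := by
      rw [Finset.mul_sum]
      refine Finset.sum_congr rfl fun k _ => ?_
      rw [Nat.add_sub_add_right]; ring
    rw [e, ← ih, Nat.sub_zero, ← bP_inv (n + 1) d, Finset.mul_sum, pow_zero, one_mul]
    have s : ∀ l, (((n + 1 + 1).choose (l + 1) : ℕ) : ℝ)
        = (n + 1).choose l + (n + 1).choose (l + 1) := by
      intro l; rw [Nat.choose_succ_succ]; push_cast; ring
    simp only [s, add_mul, Finset.sum_add_distrib]
    rw [add_comm]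
    congr 1
    rw [Finset.sum_range_succ]
    simp only [Nat.choose_succ_self, Nat.cast_zero, zero_mul, add_zero]
    refine Finset.sum_congr rfl fun l hl => ?_
    have : n + 1 - l = (n - l) + 1 := by have := Finset.mem_range.1 hl; omega
    rw [this]; ring

lemma G_eq (n : ℕ) (d : ℝ) :
    ∑ l ∈ Finset.range n, ((n + 1).choose (l + 2) : ℝ) * bernoulliPoly l (-d) * d ^ (n - l - 1)
      = ∑ k ∈ Finset.range (n + 1), (k * d ^ (k - 1)) * bernoulliPoly (n - k) 0 := by
  induction n with
  | zero => simp
  | succ n ih =>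
    rw [Finset.sum_range_succ' (fun k : ℕ => (k * d ^ (k - 1)) * bernoulliPoly (n + 1 - k) 0)]
    have e : ∑ k ∈ Finset.range (n + 1), (((k + 1 : ℕ) : ℝ) * d ^ (k + 1 - 1)) *
          bernoulliPoly (n + 1 - (k + 1)) 0
        = ∑ k ∈ Finset.range (n + 1), d ^ k * bernoulliPoly (n - k) 0 +
        d * ∑ k ∈ Finset.range (n + 1), (k * d ^ (k - 1)) * bernoulliPoly (n - k) 0 := by
      rw [Finset.mul_sum, ← Finset.sum_add_distrib]
      refine Finset.sum_congr rfl fun k _ => ?_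
      rw [Nat.add_sub_add_right]
      rcases k with _ | k
      · simp
      · simp only [Nat.add_sub_cancel]; push_cast; ring
    rw [e, ← ih, ← H_eq, Finset.mul_sum]
    have s : ∀ l, (((n + 1 + 1).choose (l + 2) : ℕ) : ℝ)
        = (n + 1).choose (l + 1) + (n + 1).choose (l + 2) := by
      intro l; rw [Nat.choose_succ_succ]; push_cast; ring
    simp only [s, add_mul, Finset.sum_add_distrib, Nat.cast_zero, zero_mul, add_zero]
    congr 1
    · refine Finset.sum_congr rfl fun l hl => ?_
      have : n + 1 - l - 1 = n - l := by omega
      rw [this]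
    · rw [Finset.sum_range_succ]
      simp only [Nat.choose_succ_self, Nat.cast_zero, zero_mul, add_zero]
      refine Finset.sum_congr rfl fun l hl => ?_
      have : n + 1 - l - 1 = (n - l - 1) + 1 := by have := Finset.mem_range.1 hl; omega
      rw [this]; ring

noncomputable def SS (n : ℕ) (d y : ℝ) : ℝ :=
  ∑ k ∈ Finset.range (n + 1), bernoulliPoly k (d + y) * bernoulliPoly (n - k) y

noncomputable def TT (n : ℕ) (d y : ℝ) : ℝ :=
  ∑ l ∈ Finset.range (n + 1), ((n + 1).choose (l + 1) : ℝ) / ((l : ℝ) + 2) *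
        (bernoulliPoly l d * bernoulliPoly (n - l) y +
          bernoulliPoly l (-d) * bernoulliPoly (n - l) (d + y))

noncomputable def RR (n : ℕ) (d y : ℝ) : ℝ :=
  (bernoulliPoly (n + 1) (d + y) + bernoulliPoly (n + 1) y) * (d ^ 2)⁻¹ -
    (bernoulliPoly (n + 2) (d + y) - bernoulliPoly (n + 2) y) * (2 / ((n : ℝ) + 2) * (d ^ 3)⁻¹)

noncomputable def FF (n : ℕ) (d y : ℝ) : ℝ := SS n d y - TT n d y - RR n d y

lemma bP_deriv' (n : ℕ) (d y : ℝ) :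
    HasDerivAt (fun y => bernoulliPoly n (d + y)) ((n : ℝ) * bernoulliPoly (n - 1) (d + y)) y :=
  (bP_deriv n (d + y)).comp_const_add d y

lemma SS_deriv (n : ℕ) (d y : ℝ) : HasDerivAt (SS (n + 1) d) (((n : ℝ) + 2) * SS n d y) y := by
  have h : HasDerivAt (SS (n + 1) d) _ y :=
    HasDerivAt.fun_sum (fun k _ => (bP_deriv' k d y).mul (bP_deriv (n + 1 - k) y))
  convert h using 1
  rw [Finset.sum_add_distrib, Finset.sum_range_succ' _ (n + 1),
    Finset.sum_range_succ _ (n + 1)]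
  simp only [Nat.sub_self, Nat.cast_zero, zero_mul, mul_zero, add_zero]
  rw [← Finset.sum_add_distrib, SS, Finset.mul_sum]
  refine Finset.sum_congr rfl fun k hk => ?_
  have hk' : k ≤ n := by have := Finset.mem_range.1 hk; omega
  have e : n + 1 - k - 1 = n - k := by omega
  rw [e, show n + 1 - (k + 1) = n - k by omega, show k + 1 - 1 = k by omega, Nat.cast_sub (by omega)]
  push_cast
  ring

lemma TT_deriv (n : ℕ) (d y : ℝ) : HasDerivAt (TT (n + 1) d) (((n : ℝ) + 2) * TT n d y) y := by
  have h : HasDerivAt (TT (n + 1) d) _ y :=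
    HasDerivAt.fun_sum (fun l _ => (((bP_deriv (n + 1 - l) y).const_mul (bernoulliPoly l d)).add
      ((bP_deriv' (n + 1 - l) d y).const_mul (bernoulliPoly l (-d)))).const_mul
      (((n + 1 + 1).choose (l + 1) : ℝ) / ((l : ℝ) + 2)))
  convert h using 1
  rw [Finset.sum_range_succ _ (n + 1)]
  simp only [Nat.sub_self, Nat.cast_zero, zero_mul, mul_zero, add_zero]
  rw [TT, Finset.mul_sum]
  refine Finset.sum_congr rfl fun l hl => ?_
  have hl' : l ≤ n := by have := Finset.mem_range.1 hl; omega
  have e : n + 1 - l - 1 = n - l := by omega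
  have c := Nat.choose_mul_succ_eq (n + 1) (l + 1)
  rw [Nat.add_sub_add_right] at c
  have c' : ((n + 1).choose (l + 1) : ℝ) * (n + 2) =
      (n + 1 + 1).choose (l + 1) * ((n + 1 - l : ℕ) : ℝ) := by
    have := congrArg (Nat.cast : ℕ → ℝ) c
    push_cast at this ⊢
    linarith
  rw [e]
  linear_combination (1 / ((l : ℝ) + 2) * (bernoulliPoly l d * bernoulliPoly (n - l) y +
          bernoulliPoly l (-d) * bernoulliPoly (n - l) (d + y))) * c'

lemma RR_deriv (n : ℕ) (d y : ℝ) : HasDerivAt (RR (n + 1) d) (((n : ℝ) + 2) * RR n d y) y := by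
  have h : HasDerivAt (RR (n + 1) d) _ y :=
    (((bP_deriv' (n + 1 + 1) d y).add (bP_deriv (n + 1 + 1) y)).mul_const _).sub
    (((bP_deriv' (n + 1 + 2) d y).sub (bP_deriv (n + 1 + 2) y)).mul_const _)
  convert h using 1
  simp only [RR, Nat.add_sub_cancel, show n + 1 + 2 - 1 = n + 2 by omega]
  have h2 : (n : ℝ) + 2 ≠ 0 := by positivity
  have h3 : (n : ℝ) + 1 + 2 ≠ 0 := by positivity
  push_cast
  generalize (d ^ 2)⁻¹ = u
  generalize (d ^ 3)⁻¹ = v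
  field_simp
  ring

lemma FF_deriv (n : ℕ) (d y : ℝ) : HasDerivAt (FF (n + 1) d) (((n : ℝ) + 2) * FF n d y) y := by
  have h : HasDerivAt (FF (n + 1) d) _ y :=
    ((SS_deriv n d y).sub (TT_deriv n d y)).sub (RR_deriv n d y)
  convert h using 1
  simp only [FF]; ring

lemma bP_one (m : ℕ) : bernoulliPoly m 1 = bernoulliPoly m 0 + m * 0 ^ (m - 1) := by
  simpa using bP_shift m 0

lemma SS_diff (n : ℕ) (d : ℝ) : SS (n + 1) d 1 - SS (n + 1) d 0 =
    ∑ k ∈ Finset.range (n + 1 + 1), (k * d ^ (k - 1)) * bernoulliPoly (n + 1 - k) 0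
      + bernoulliPoly n d + n * d ^ (n - 1) := by
  have e : ∑ k ∈ Finset.range (n + 1 + 1), bernoulliPoly k (1 + d) *
      (((n + 1 - k : ℕ) : ℝ) * 0 ^ (n + 1 - k - 1)) = bernoulliPoly n (1 + d) := by
    rw [Finset.sum_range_succ, Finset.sum_range_succ, Finset.sum_eq_zero]
    · simp
    · intro k hk
      have : n + 1 - k - 1 ≠ 0 := by have := Finset.mem_range.1 hk; omega
      simp [this]
  rw [add_assoc, ← bP_shift, ← e, SS, SS, ← Finset.sum_sub_distrib, ← Finset.sum_add_distrib]
  refine Finset.sum_congr rfl fun k _ => ?_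
  rw [add_comm d 1, bP_one, bP_shift, add_zero]
  ring

lemma TT_diff (n : ℕ) (d : ℝ) : TT (n + 1) d 1 - TT (n + 1) d 0 =
    ∑ k ∈ Finset.range (n + 1 + 1), (k * d ^ (k - 1)) * bernoulliPoly (n + 1 - k) 0
      + bernoulliPoly n d := by
  have c : ∀ l ∈ Finset.range (n + 1 + 1), ((n + 1 + 1).choose (l + 1) : ℝ) / ((l : ℝ) + 2)
      * ((n + 1 - l : ℕ) : ℝ) = (n + 1 + 1).choose (l + 2) := by
    intro l hl
    have c := Nat.choose_succ_right_eq (n + 1 + 1) (l + 1)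
    rw [Nat.add_sub_add_right] at c
    have c' := congrArg (Nat.cast : ℕ → ℝ) c
    push_cast at c'
    have h2 : (l : ℝ) + 2 ≠ 0 := by positivity
    field_simp
    push_cast
    linarith
  have e : ∑ l ∈ Finset.range (n + 1 + 1), ((n + 1 + 1).choose (l + 2) : ℝ) *
      bernoulliPoly l d * 0 ^ (n + 1 - l - 1) = bernoulliPoly n d := by
    rw [Finset.sum_range_succ, Finset.sum_range_succ, Finset.sum_eq_zero]
    · simp
    · intro k hk
      have : n + 1 - k - 1 ≠ 0 := by have := Finset.mem_range.1 hk; omega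
      simp [this]
  have g : ∑ l ∈ Finset.range (n + 1 + 1), ((n + 1 + 1).choose (l + 2) : ℝ) *
      bernoulliPoly l (-d) * d ^ (n + 1 - l - 1) =
      ∑ k ∈ Finset.range (n + 1 + 1), (k * d ^ (k - 1)) * bernoulliPoly (n + 1 - k) 0 := by
    rw [← G_eq, Finset.sum_range_succ]
    simp
  rw [← e, ← g, TT, TT, ← Finset.sum_sub_distrib, ← Finset.sum_add_distrib]
  refine Finset.sum_congr rfl fun l hl => ?_
  rw [add_comm d 1, bP_one, bP_shift, add_zero, ← c l hl]
  ring

lemma RR_diff (n : ℕ) (d : ℝ) (hd : d ≠ 0) :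
    RR (n + 1) d 1 - RR (n + 1) d 0 = n * d ^ (n - 1) := by
  simp only [RR, add_comm d 1, bP_one, bP_shift, add_zero]
  have h3 : (n : ℝ) + 1 + 2 ≠ 0 := by positivity
  simp only [show n + 1 + 1 - 1 = n + 1 by omega, show n + 1 + 2 - 1 = n + 2 by omega]
  push_cast
  rcases n with _ | n
  · simp; field_simp; ring
  · push_cast at *
    rw [zero_pow (by omega), zero_pow (by omega)]
    field_simp
    ring

lemma FF_diff (n : ℕ) (d : ℝ) (hd : d ≠ 0) : FF (n + 1) d 1 = FF (n + 1) d 0 := by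
  have h1 := SS_diff n d
  have h2 := TT_diff n d
  have h3 := RR_diff n d hd
  simp only [FF]
  linarith

lemma FF_const (n : ℕ) (d : ℝ) (hd : d ≠ 0) (h : ∀ y, FF n d y = FF n d 0) (y : ℝ) :
    FF n d y = 0 := by
  have k := const_of_deriv (fun y => FF (n + 1) d y - y * (((n : ℝ) + 2) * FF n d 0)) (by
    intro y
    have := (FF_deriv n d y).sub ((hasDerivAt_id y).mul_const (((n : ℝ) + 2) * FF n d 0))
    refine this.congr_deriv ?_
    rw [h y]; ring) 1 0
  simp only [FF_diff n d hd] at k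
  have h2 : (n : ℝ) + 2 ≠ 0 := by positivity
  have : ((n : ℝ) + 2) * FF n d 0 = 0 := by linarith
  rw [h y]
  exact (mul_eq_zero.1 this).resolve_left h2

lemma FF_zero (n : ℕ) (d : ℝ) (hd : d ≠ 0) : ∀ y, FF n d y = 0 := by
  induction n with
  | zero =>
    intro y
    simp [FF, SS, TT, RR, bernoulliPoly, Finset.sum_range_succ, Nat.choose]
    field_simp
    ring
  | succ n ih =>
    refine FF_const (n + 1) d hd fun y => const_of_deriv _ (fun z => ?_) y 0
    have := FF_deriv n d z
    rwa [ih, mul_zero] at this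

theorem stmt_1 (n : ℕ) (x y : ℝ) (hxy : x ≠ y) :
    (∑ k ∈ Finset.range (n + 1), bernoulliPoly k x * bernoulliPoly (n - k) y) -
      (∑ l ∈ Finset.range (n + 1), ((n + 1).choose (l + 1) : ℝ) *
        (bernoulliPoly l (x - y) * bernoulliPoly (n - l) y +
          bernoulliPoly l (y - x) * bernoulliPoly (n - l) x) / ((l : ℝ) + 2)) =
    (bernoulliPoly (n + 1) x + bernoulliPoly (n + 1) y) / (x - y) ^ 2 -
      2 / ((n : ℝ) + 2) * ((bernoulliPoly (n + 2) x - bernoulliPoly (n + 2) y) / (x - y) ^ 3) := by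
  have h := FF_zero n (x - y) (sub_ne_zero.2 hxy) y
  simp only [FF, SS, TT, RR, sub_add_cancel, neg_sub] at h
  have e : ∀ l : ℕ, ((n + 1).choose (l + 1) : ℝ) *
        (bernoulliPoly l (x - y) * bernoulliPoly (n - l) y +
          bernoulliPoly l (y - x) * bernoulliPoly (n - l) x) / ((l : ℝ) + 2) =
      ((n + 1).choose (l + 1) : ℝ) / ((l : ℝ) + 2) *
        (bernoulliPoly l (x - y) * bernoulliPoly (n - l) y +
          bernoulliPoly l (y - x) * bernoulliPoly (n - l) x) := fun l => by ring
  simp only [e]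
  linear_combination h
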